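/- arXiv:1305.1752 — 6 statements merged into one kernel-verified Lean document; each statement's English description precedes it below -/
import Mathlib

section
/- Let L be a finite geometric lattice and let x, y ∈ L be indecomposable elements with x ⊓ y ≠ ⊥. Then x ⊔ y is indecomposable. -/
/-- A finite lattice is atomistic: every element is a join (finite sup) of atoms. -/
def Atomistic (L : Type*) [Lattice L] [OrderBot L] : Prop :=
  ∀ x : L, ∃ s : Finset L, (∀ a ∈ s, IsAtom a) ∧ s.sup id = x

/-- Semimodularity: whenever `a ⊓ b` is covered by `a`, `b` is covered by `a ⊔ b`. -/
def Semimodular (L : Type*) [Lattice L] : Prop :=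
  ∀ a b : L, a ⊓ b ⋖ a → b ⋖ a ⊔ b

/-- An element `x ≠ ⊥` is decomposable if `x = y ⊔ z` with `y, z ≠ ⊥` such that every atom
below `x` lies below exactly one of `y` and `z`. -/
def Decomposable {L : Type*} [Lattice L] [OrderBot L] (x : L) : Prop :=
  ∃ y z : L, y ≠ ⊥ ∧ z ≠ ⊥ ∧ y ⊔ z = x ∧
    ∀ a : L, IsAtom a → a ≤ x → Xor' (a ≤ y) (a ≤ z)

/-- An element is indecomposable if it is `≠ ⊥` and not decomposable. -/
def Indecomposable {L : Type*} [Lattice L] [OrderBot L] (x : L) : Prop :=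
  x ≠ ⊥ ∧ ¬ Decomposable x

theorem Atomistic.le_of_forall_atom_le {L : Type*} [Lattice L] [OrderBot L] (hatom : Atomistic L)
    {x w : L} (h : ∀ a : L, IsAtom a → a ≤ x → a ≤ w) : x ≤ w := by
  obtain ⟨s, hs, rfl⟩ := hatom x
  exact Finset.sup_le fun a ha => h a (hs a ha) (Finset.le_sup (f := id) ha)

theorem Atomistic.exists_atom_le {L : Type*} [Lattice L] [OrderBot L] (hatom : Atomistic L)
    {x : L} (hx : x ≠ ⊥) : ∃ a : L, IsAtom a ∧ a ≤ x := by
  by_contra! h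
  exact hx (le_bot_iff.mp (hatom.le_of_forall_atom_le fun a ha hax => absurd hax (h a ha)))

/-- If the atoms below an indecomposable `x` are split between `u` and `v`, then `x` lies
entirely below one of them. -/
theorem Indecomposable.le_or_le {L : Type*} [Lattice L] [OrderBot L] (hatom : Atomistic L)
    {x u v : L} (hx : Indecomposable x)
    (h : ∀ a : L, IsAtom a → a ≤ x → Xor (a ≤ u) (a ≤ v)) : x ≤ u ∨ x ≤ v := by
  by_cases hu : x ⊓ u = ⊥
  · refine Or.inr (hatom.le_of_forall_atom_le fun a ha hax => ?_)
    refine (Xor.or (h a ha hax)).resolve_left fun hau => ha.1 ?_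
    exact le_bot_iff.mp (hu ▸ le_inf hax hau)
  by_cases hv : x ⊓ v = ⊥
  · refine Or.inl (hatom.le_of_forall_atom_le fun a ha hax => ?_)
    refine (Xor.or (h a ha hax)).resolve_right fun hav => ha.1 ?_
    exact le_bot_iff.mp (hv ▸ le_inf hax hav)
  refine absurd ⟨x ⊓ u, x ⊓ v, hu, hv, le_antisymm (sup_le inf_le_left inf_le_left) ?_, ?_⟩ hx.2
  · refine hatom.le_of_forall_atom_le fun a ha hax => ?_
    rcases Xor.or (h a ha hax) with hau | hav
    · exact (le_inf hax hau).trans le_sup_left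
    · exact (le_inf hax hav).trans le_sup_right
  · intro a ha hax
    change Xor (a ≤ x ⊓ u) (a ≤ x ⊓ v)
    simpa [hax] using h a ha hax

/-- In a finite geometric lattice, if `x` and `y` are indecomposable and not disjoint, then
`x ⊔ y` is indecomposable. -/
theorem stmt1 {L : Type*} [Lattice L] [Fintype L] [BoundedOrder L]
    (hatom : Atomistic L) (hsemi : Semimodular L)
    (x y : L) (hx : Indecomposable x) (hy : Indecomposable y) (hxy : x ⊓ y ≠ ⊥) :
    Indecomposable (x ⊔ y) := by
  refine ⟨fun h => hx.1 (le_bot_iff.mp (h ▸ le_sup_left)), ?_⟩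
  rintro ⟨u, v, hu, hv, huv, h⟩
  have not_both : ∀ a : L, IsAtom a → a ≤ x ⊔ y → a ≤ u → a ≤ v → False := fun a ha hau h₁ h₂ =>
    (h a ha hau).elim (fun k => k.2 h₂) (fun k => k.2 h₁)
  obtain ⟨a, ha, haxy⟩ := hatom.exists_atom_le hxy
  have hax : a ≤ x := haxy.trans inf_le_left
  have hay : a ≤ y := haxy.trans inf_le_right
  have ha_sup : a ≤ x ⊔ y := hax.trans le_sup_left
  rcases hx.le_or_le hatom fun b hb hbx => h b hb (hbx.trans le_sup_left) with hxu | hxv <;>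
    rcases hy.le_or_le hatom fun b hb hby => h b hb (hby.trans le_sup_right) with hyu | hyv
  · obtain ⟨b, hb, hbv⟩ := hatom.exists_atom_le hv
    have hb_sup : b ≤ x ⊔ y := hbv.trans (huv ▸ le_sup_right)
    exact not_both b hb hb_sup (hb_sup.trans (sup_le hxu hyu)) hbv
  · exact not_both a ha ha_sup (hax.trans hxu) (hay.trans hyv)
  · exact not_both a ha ha_sup (hay.trans hyu) (hax.trans hxv)
  · obtain ⟨b, hb, hbu⟩ := hatom.exists_atom_le hu
    have hb_sup : b ≤ x ⊔ y := hbu.trans (huv ▸ le_sup_left)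
    exact not_both b hb hb_sup hbu (hb_sup.trans (sup_le hxv hyv))
end

section
/- Let L be a finite geometric lattice, let x_1, …, x_m ∈ L be dependent, fix an index 1 ≤ j ≤ m, and define y_1, …, y_m by y_i = x_i for i ≠ j and y_j ⋖ x_j (y_j is covered by x_j). Then either y_1, …, y_m are dependent, or y_1 ⊔ ⋯ ⊔ y_m = x_1 ⊔ ⋯ ⊔ x_m. -/
/-- `rk` is the rank function of a finite (semimodular) lattice: it vanishes at `⊥` and
increases by one along covering relations. -/
def IsRankFunction {L : Type*} [Lattice L] [OrderBot L] (rk : L → ℕ) : Prop :=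
  rk ⊥ = 0 ∧ ∀ x y : L, x ⋖ y → rk y = rk x + 1

/-- Elements `x_1, …, x_m` are dependent if `∑ rk (x_i) > rk (⊔ x_i)`. -/
def Dependent {L : Type*} [Lattice L] [OrderBot L] [Fintype L]
    (rk : L → ℕ) {m : ℕ} (xs : Fin m → L) : Prop :=
  rk (Finset.univ.sup xs) < ∑ i, rk (xs i)

/-- If `x_1, …, x_m` are dependent, `y_j ⋖ x_j` for one index `j` and `y_i = x_i` otherwise,
then either `y_1, …, y_m` are dependent or `⊔ y_i = ⊔ x_i`. -/
theorem stmt3 {L : Type*} [Lattice L] [Fintype L] [BoundedOrder L]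
    (hatom : Atomistic L) (hsemi : Semimodular L)
    (rk : L → ℕ) (hrk : IsRankFunction rk)
    {m : ℕ} (xs : Fin m → L) (hdep : Dependent rk xs)
    (j : Fin m) (ys : Fin m → L)
    (hys : ∀ i, i ≠ j → ys i = xs i) (hcov : ys j ⋖ xs j) :
    Dependent rk ys ∨ Finset.univ.sup ys = Finset.univ.sup xs := by
  have hle : ys j ≤ Finset.univ.sup ys := Finset.le_sup (Finset.mem_univ j)
  have hsup : Finset.univ.sup xs = xs j ⊔ Finset.univ.sup ys := by
    apply le_antisymm
    · refine Finset.sup_le fun i _ => ?_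
      rcases eq_or_ne i j with rfl | hij
      · exact le_sup_left
      · rw [← hys i hij]
        exact le_sup_of_le_right (Finset.le_sup (Finset.mem_univ i))
    · refine sup_le (Finset.le_sup (Finset.mem_univ j)) (Finset.sup_mono_fun fun i _ => ?_)
      rcases eq_or_ne i j with rfl | hij
      · exact hcov.le
      · exact (hys i hij).le
  rcases hcov.eq_or_eq (le_inf hcov.le hle) inf_le_left with h | h
  · left
    have hrank := hrk.2 _ _ (hsemi (xs j) (Finset.univ.sup ys) (h.symm ▸ hcov))
    have hsum : ∑ i, rk (xs i) = ∑ i, rk (ys i) + 1 := by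
      rw [← Finset.add_sum_erase _ _ (Finset.mem_univ j),
        ← Finset.add_sum_erase _ (fun i => rk (ys i)) (Finset.mem_univ j), hrk.2 _ _ hcov,
        Finset.sum_congr rfl fun i hi => by rw [← hys i (Finset.ne_of_mem_erase hi)]]
      omega
    unfold Dependent at hdep ⊢
    rw [hsup] at hdep
    omega
  · right
    rw [hsup, eq_comm, sup_eq_right]
    exact inf_eq_left.mp h
end

section
/- Let L and Λ be finite geometric lattices, 0 ≤ k ≤ rk L, and l : L_{≥k} → Λ a non-degenerate k-th truncation. Fix x̃ ∈ Λ and let x_1, …, x_m be the maximal elements of L_{≥k} satisfying l(x_i) ≤ x̃. Then the set {x ∈ L_{≥k} : l(x) ≤ x̃} is the disjoint union of the sets {x ∈ L_{≥k} : x ≤ x_i} for i = 1, …, m; that is, every x ∈ L_{≥k} with l(x) ≤ x̃ satisfies x ≤ x_i for exactly one index i (in particular rk_L(x_i ⊓ x_j) < k for i ≠ j). -/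
/-- A function that increases by one along covering relations of a finite lattice is monotone. -/
theorem IsRankFunction.monotone {L : Type*} [Lattice L] [OrderBot L] [Fintype L] {rk : L → ℕ}
    (hrk : IsRankFunction rk) : Monotone rk := by
  classical
  let : LocallyFiniteOrder L := Fintype.toLocallyFiniteOrder
  rw [monotone_iff_forall_covBy]
  intro a b hab
  rw [hrk.2 a b hab]
  exact Nat.le_succ _

/-- Lemma on non-degenerate `k`-th truncations `l : L_{≥k} → Λ`: given `x̃ ∈ Λ`, every
`x ∈ L_{≥k}` with `l x ≤ x̃` lies below exactly one maximal element of
`{z ∈ L_{≥k} : l z ≤ x̃}`; moreover any two distinct such maximal elements meet in rank `< k`. -/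
theorem stmt4 {L Λ : Type*} [Lattice L] [Fintype L] [BoundedOrder L]
    [Lattice Λ] [Fintype Λ] [BoundedOrder Λ]
    (hatomL : Atomistic L) (hsemiL : Semimodular L)
    (hatomΛ : Atomistic Λ) (hsemiΛ : Semimodular Λ)
    (rkL : L → ℕ) (hrkL : IsRankFunction rkL)
    (rkΛ : Λ → ℕ) (hrkΛ : IsRankFunction rkΛ)
    (k : ℕ) (hk : k ≤ rkL ⊤)
    (l : {x : L // k ≤ rkL x} → Λ)
    (hmono : ∀ x y : {x : L // k ≤ rkL x}, x.1 ≤ y.1 → l x ≤ l y)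
    (hlrank : ∀ x : {x : L // k ≤ rkL x}, rkΛ (l x) = rkL x.1 - k)
    (hljoin : ∀ x y z : {x : L // k ≤ rkL x}, z.1 = x.1 ⊔ y.1 →
      k ≤ rkL (x.1 ⊓ y.1) → l z = l x ⊔ l y)
    (xt : Λ) :
    (∀ x : {x : L // k ≤ rkL x}, l x ≤ xt →
      ∃! z : {x : L // k ≤ rkL x},
        (l z ≤ xt ∧ ∀ w : {x : L // k ≤ rkL x}, l w ≤ xt → z.1 ≤ w.1 → w = z) ∧
        x.1 ≤ z.1) ∧
    (∀ z w : {x : L // k ≤ rkL x},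
      (l z ≤ xt ∧ ∀ w' : {x : L // k ≤ rkL x}, l w' ≤ xt → z.1 ≤ w'.1 → w' = z) →
      (l w ≤ xt ∧ ∀ w' : {x : L // k ≤ rkL x}, l w' ≤ xt → w.1 ≤ w'.1 → w' = w) →
      z ≠ w → rkL (z.1 ⊓ w.1) < k) := by
  have hrk_mono : Monotone rkL := hrkL.monotone
  have meet_lt : ∀ z w : {x : L // k ≤ rkL x},
      (l z ≤ xt ∧ ∀ w' : {x : L // k ≤ rkL x}, l w' ≤ xt → z.1 ≤ w'.1 → w' = z) →
      (l w ≤ xt ∧ ∀ w' : {x : L // k ≤ rkL x}, l w' ≤ xt → w.1 ≤ w'.1 → w' = w) →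
      z ≠ w → rkL (z.1 ⊓ w.1) < k := by
    intro z w hz hw hne
    by_contra! hle
    let u : {x : L // k ≤ rkL x} := ⟨z.1 ⊔ w.1, z.2.trans (hrk_mono le_sup_left)⟩
    have hu : l u ≤ xt := by
      rw [hljoin z w u rfl hle]
      exact sup_le hz.1 hw.1
    exact hne ((hz.2 u hu le_sup_left).symm.trans (hw.2 u hu le_sup_right))
  refine ⟨fun x hx => ?_, meet_lt⟩
  obtain ⟨z, hxz, hz⟩ :=
    (Set.toFinite {z : {x : L // k ≤ rkL x} | l z ≤ xt}).exists_le_maximal hx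
  have hzmax : ∀ w : {x : L // k ≤ rkL x}, l w ≤ xt → z.1 ≤ w.1 → w = z :=
    fun w hw hzw => le_antisymm (hz.2 hw hzw) hzw
  refine ⟨z, ⟨⟨hz.1, hzmax⟩, hxz⟩, fun w hw => ?_⟩
  by_contra hne
  exact (meet_lt w z hw.1 ⟨hz.1, hzmax⟩ hne).not_ge
    (x.2.trans (hrk_mono (le_inf hw.2 hxz)))
end

section
/- Let K be a field, U a finite-dimensional K-vector space, H a finite hyperplane arrangement in U* with intersection lattice L, and Q ⊆ U* a k-dimensional linear subspace such that x ∩ Q = {0} for every x ∈ L of codimension exactly k in U*. Let π : U* → U*/Q be the quotient map. Then: (i) x ∩ Q = {0}, and hence dim π(x) = dim x, for every x ∈ L of codimension ≥ k; (ii) the codimension of π(x) in U*/Q equals codim_{U*}(x) − k for every x ∈ L of codimension ≥ k; (iii) if x, y ∈ L have codimension ≥ k and their meet x ⊓_L y in L (i.e. the intersection of all hyperplanes of H containing both x and y) has codimension ≥ k, then π(x ∩ y) = π(x) ∩ π(y). -/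
/-- The intersection lattice of a finite hyperplane arrangement `HH` in `W`: all intersections
of subfamilies of `HH` (the empty intersection being `W` itself). -/
def InterLattice {K W : Type*} [Field K] [AddCommGroup W] [Module K W]
    (HH : Finset (Submodule K W)) : Set (Submodule K W) :=
  {x | ∃ s : Finset (Submodule K W), s ⊆ HH ∧ x = s.inf id}

open Module in
/-- Intersecting with a hyperplane lowers the dimension by at most one. -/
theorem finrank_le_finrank_inf_hyperplane_add_one {K W : Type*} [Field K] [AddCommGroup W]
    [Module K W] [FiniteDimensional K W] {h : Submodule K W}
    (hh : finrank K W = finrank K h + 1) (x : Submodule K W) :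
    finrank K x ≤ finrank K ↥(h ⊓ x) + 1 := by
  have h1 := Submodule.finrank_sup_add_finrank_inf_eq h x
  have h2 := Submodule.finrank_le (h ⊔ x)
  omega

open Module in
/-- An intersection of hyperplanes of codimension at least `k` lies in an intersection of some of
them that has codimension exactly `k`. -/
theorem exists_subset_codim_inf_eq {K W : Type*} [Field K] [AddCommGroup W]
    [Module K W] [FiniteDimensional K W] {k : ℕ} (s : Finset (Submodule K W))
    (hs : ∀ h ∈ s, finrank K W = finrank K h + 1)
    (hk : k ≤ finrank K W - finrank K ↥(s.inf id)) :
    ∃ t ⊆ s, finrank K W - finrank K ↥(t.inf id) = k := by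
  classical
  induction s using Finset.induction_on with
  | empty => exact ⟨∅, subset_rfl, by
    rw [Finset.inf_empty, finrank_top] at hk ⊢
    omega⟩
  | insert h s _ ih =>
    by_cases hks : k ≤ finrank K W - finrank K ↥(s.inf id)
    · obtain ⟨t, hts, ht⟩ := ih (fun g hg => hs g (Finset.mem_insert_of_mem hg)) hks
      exact ⟨t, hts.trans (Finset.subset_insert h s), ht⟩
    · refine ⟨insert h s, subset_rfl, ?_⟩
      have := finrank_le_finrank_inf_hyperplane_add_one (hs h (Finset.mem_insert_self h s))
        (s.inf id)
      rw [Finset.inf_insert, id] at hk ⊢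
      omega

/-- The quotient map by a subspace meeting `m` trivially preserves intersections of subspaces
of `m`. -/
theorem Submodule.map_mkQ_inf_of_le {R M : Type*} [Ring R] [AddCommGroup M] [Module R M]
    {Q m x y : Submodule R M} (hm : m ⊓ Q = ⊥) (hx : x ≤ m) (hy : y ≤ m) :
    (x ⊓ y).map Q.mkQ = x.map Q.mkQ ⊓ y.map Q.mkQ := by
  refine le_antisymm (Submodule.map_inf_le _) ?_
  rintro _ ⟨⟨a, ha, rfl⟩, b, hb, hab⟩
  have hQ : b - a ∈ Q := (Submodule.Quotient.eq Q).mp hab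
  have h0 : b - a ∈ m ⊓ Q := ⟨m.sub_mem (hy hb) (hx ha), hQ⟩
  rw [hm, Submodule.mem_bot, sub_eq_zero] at h0
  exact ⟨a, ⟨ha, h0 ▸ hb⟩, rfl⟩

/-- Projection of a hyperplane arrangement modulo a subspace `Q` meeting all codimension-`k`
intersections trivially: ranks behave as expected and meets project correctly. -/
theorem stmt5 {K : Type*} [Field K] {W : Type*} [AddCommGroup W] [Module K W]
    [FiniteDimensional K W]
    (HH : Finset (Submodule K W))
    (hhyp : ∀ h ∈ HH, Module.finrank K W = Module.finrank K h + 1)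
    (k : ℕ) (Q : Submodule K W) (hQdim : Module.finrank K Q = k)
    (hQ : ∀ x ∈ InterLattice HH, Module.finrank K W - Module.finrank K x = k → x ⊓ Q = ⊥) :
    (∀ x ∈ InterLattice HH, k ≤ Module.finrank K W - Module.finrank K x →
      x ⊓ Q = ⊥ ∧ Module.finrank K (Submodule.map Q.mkQ x) = Module.finrank K x) ∧
    (∀ x ∈ InterLattice HH, k ≤ Module.finrank K W - Module.finrank K x →
      Module.finrank K (W ⧸ Q) - Module.finrank K (Submodule.map Q.mkQ x) =
        (Module.finrank K W - Module.finrank K x) - k) ∧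
    (∀ x ∈ InterLattice HH, ∀ y ∈ InterLattice HH,
      k ≤ Module.finrank K W - Module.finrank K x →
      k ≤ Module.finrank K W - Module.finrank K y →
      k ≤ Module.finrank K W -
        Module.finrank K ↥(sInf {h : Submodule K W | h ∈ HH ∧ x ≤ h ∧ y ≤ h}) →
      Submodule.map Q.mkQ (x ⊓ y) = Submodule.map Q.mkQ x ⊓ Submodule.map Q.mkQ y) := by
  have hbot : ∀ x ∈ InterLattice HH, k ≤ Module.finrank K W - Module.finrank K x →
      x ⊓ Q = ⊥ := by
    rintro _ ⟨s, hs, rfl⟩ hk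
    obtain ⟨t, hts, ht⟩ := exists_subset_codim_inf_eq s (fun h hh => hhyp h (hs hh)) hk
    exact le_bot_iff.mp ((inf_le_inf_right Q (Finset.inf_mono hts)).trans
      (hQ _ ⟨t, hts.trans hs, rfl⟩ ht).le)
  have hrank : ∀ x : Submodule K W, x ⊓ Q = ⊥ →
      Module.finrank K (Submodule.map Q.mkQ x) = Module.finrank K x := by
    intro x hx
    rw [← LinearMap.range_domRestrict]
    refine LinearMap.finrank_range_of_inj (LinearMap.injective_domRestrict_iff.mpr ?_)
    rwa [Submodule.ker_mkQ, disjoint_iff]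
  refine ⟨fun x hx hk => ⟨hbot x hx hk, hrank x (hbot x hx hk)⟩, fun x hx hk => ?_,
    fun x _ y _ _ _ hk => ?_⟩
  · have := Q.finrank_quotient_add_finrank
    rw [hrank x (hbot x hx hk)]
    omega
  · classical
    refine Submodule.map_mkQ_inf_of_le (hbot _ ⟨HH.filter fun h => x ≤ h ∧ y ≤ h,
      Finset.filter_subset _ _, ?_⟩ hk) (le_sInf fun h hh => hh.2.1) (le_sInf fun h hh => hh.2.2)
    rw [Finset.inf_id_eq_sInf, Finset.coe_filter]
end

section
/- Let L be a finite geometric lattice of rank n, R a ring with 1, and V a chain complex of R-modules with a compatible L-grading such that ∂_a : V_a → V_⊥ is injective for every atom a of L and the subcomplex V_{≤x} is acyclic for every x ∈ L. Then V coincides with the minimal complex of the atomic datum (V_⊥, (V_a)_{a ∈ A(L)}); concretely, for every x ∈ L of rank ≥ 2 the map ∂_x : V_x → V_{≺x} is injective and its image equals Ker(∂ restricted to V_{≺x}). -/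
section ComplexDefs

variable {R : Type*} [Ring R] {L : Type*} [Lattice L] [BoundedOrder L]

/-- A compatible `L`-grading on a chain complex `(V, d)` of `R`-modules:
`d` squares to zero, the graded piece `V_x` lives in degree `rk x` (we record a piece in every
degree, which is `⊥` off the rank), each degree is the internal direct sum of its pieces, and
the differential maps `V_x` into `⊕_{y ⋖ x} V_y`. -/
def IsCompatGrading [DecidableEq L] (rk : L → ℕ) (V : ℕ → Type*)
    [∀ i, AddCommGroup (V i)] [∀ i, Module R (V i)]
    (d : ∀ i, V (i + 1) →ₗ[R] V i) (Vx : L → ∀ i, Submodule R (V i)) : Prop :=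
  (∀ (i : ℕ) (v : V (i + 2)), d i (d (i + 1) v) = 0) ∧
  (∀ (x : L) (i : ℕ), i ≠ rk x → Vx x i = ⊥) ∧
  (∀ i : ℕ, DirectSum.IsInternal (fun x : L => Vx x i)) ∧
  (∀ (i : ℕ) (x : L), rk x = i + 1 →
    Submodule.map (d i) (Vx x (i + 1)) ≤ ⨆ y ∈ {y : L | y ⋖ x}, Vx y i)

/-- The degree-`i` part of the subcomplex `V_{≤ x}`. -/
def Vle {V : ℕ → Type*} [∀ i, AddCommGroup (V i)] [∀ i, Module R (V i)]
    (Vx : L → ∀ i, Submodule R (V i)) (x : L) (i : ℕ) : Submodule R (V i) :=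
  ⨆ y ∈ {y : L | y ≤ x}, Vx y i

/-- Acyclicity of the subcomplex `V_{≤x}`: `Ker ∂_j = Im ∂_{j+1}` at all positions `j ≥ 1`. -/
def AcyclicOn {V : ℕ → Type*} [∀ i, AddCommGroup (V i)] [∀ i, Module R (V i)]
    (d : ∀ i, V (i + 1) →ₗ[R] V i) (Vx : L → ∀ i, Submodule R (V i)) (x : L) : Prop :=
  ∀ i : ℕ, Vle Vx x (i + 1) ⊓ LinearMap.ker (d i) =
    Submodule.map (d (i + 1)) (Vle Vx x (i + 2))

/-- Acyclicity of the complex: `Ker ∂_j = Im ∂_{j+1}` at all positions `j ≥ 1`. -/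
def Acyclic {V : ℕ → Type*} [∀ i, AddCommGroup (V i)] [∀ i, Module R (V i)]
    (d : ∀ i, V (i + 1) →ₗ[R] V i) : Prop :=
  ∀ i : ℕ, LinearMap.ker (d i) = LinearMap.range (d (i + 1))

/-- `(V, d, Vx)` is the minimal complex of its atomic datum `(V_⊥, (∂(V_a))_a)`:
the bottom piece is everything in degree `0`, the differential is injective on each atom piece,
and for `rk x ≥ 2` the differential is injective on `V_x` with image exactly the kernel of
`∂` on `V_{≺x} = ⊕_{y ⋖ x} V_y`. -/
def IsMinimal (rk : L → ℕ) {V : ℕ → Type*} [∀ i, AddCommGroup (V i)] [∀ i, Module R (V i)]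
    (d : ∀ i, V (i + 1) →ₗ[R] V i) (Vx : L → ∀ i, Submodule R (V i)) : Prop :=
  Vx ⊥ 0 = ⊤ ∧
  (∀ a : L, IsAtom a → ∀ v ∈ Vx a 1, d 0 v = 0 → v = 0) ∧
  (∀ (i : ℕ) (x : L), rk x = i + 2 →
    (∀ v ∈ Vx x (i + 2), d (i + 1) v = 0 → v = 0) ∧
    Submodule.map (d (i + 1)) (Vx x (i + 2)) =
      (⨆ y ∈ {y : L | y ⋖ x}, Vx y (i + 1)) ⊓ LinearMap.ker (d i))

/-- The subcomplex `V_{≤x}` admits an `L_{≤x}`-homotopy: a contracting homotopy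
(`h0` on the image of `∂_1`, `h j` in positions `j ≥ 1`) which moves each graded piece `V_z`
(`⊥ ≠ z ≤ x`) into `⊕_{y ⋗ z, y ≤ x} V_y`. -/
def HasLHomotopyOn (rk : L → ℕ) {V : ℕ → Type*} [∀ i, AddCommGroup (V i)]
    [∀ i, Module R (V i)] (d : ∀ i, V (i + 1) →ₗ[R] V i)
    (Vx : L → ∀ i, Submodule R (V i)) (x : L) : Prop :=
  ∃ (hmem : ∀ (i : ℕ) (v : V (i + 1)), v ∈ Vle Vx x (i + 1) → d i v ∈ Vle Vx x i)
    (h0 : ↥(Submodule.map (d 0) (Vle Vx x 1)) →ₗ[R] V 1)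
    (h : ∀ i : ℕ, ↥(Vle Vx x (i + 1)) →ₗ[R] V (i + 2)),
    (∀ v : ↥(Vle Vx x 1),
      d 1 (h 0 v) + h0 ⟨d 0 v.1, Submodule.mem_map_of_mem v.2⟩ = v.1) ∧
    (∀ (i : ℕ) (v : ↥(Vle Vx x (i + 2))),
      d (i + 2) (h (i + 1) v) + h i ⟨d (i + 1) v.1, hmem (i + 1) v.1 v.2⟩ = v.1) ∧
    (∀ (i : ℕ) (z : L), z ≤ x → rk z = i + 1 →
      ∀ v : ↥(Vle Vx x (i + 1)), v.1 ∈ Vx z (i + 1) →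
        h i v ∈ ⨆ y ∈ {y : L | z ⋖ y ∧ y ≤ x}, Vx y (i + 2))

/-- The complex is `L`-contractible: every subcomplex `V_{≤x}` admits an `L_{≤x}`-homotopy. -/
def LContractible (rk : L → ℕ) {V : ℕ → Type*} [∀ i, AddCommGroup (V i)]
    [∀ i, Module R (V i)] (d : ∀ i, V (i + 1) →ₗ[R] V i)
    (Vx : L → ∀ i, Submodule R (V i)) : Prop :=
  ∀ x : L, HasLHomotopyOn rk d Vx x

end ComplexDefs

theorem IsRankFunction.strictMono {L : Type*} [Lattice L] [OrderBot L] [Finite L] {rk : L → ℕ}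
    (hrk : IsRankFunction rk) : StrictMono rk := by
  classical
  have := Fintype.ofFinite L
  let _ : LocallyFiniteOrder L := Fintype.toLocallyFiniteOrder
  rw [strictMono_iff_forall_covBy]
  intro a b hab
  rw [hrk.2 a b hab]
  exact Nat.lt_succ_self _

theorem IsRankFunction.covBy_of_lt {L : Type*} [Lattice L] [OrderBot L] [Finite L] {rk : L → ℕ}
    (hrk : IsRankFunction rk) {x y : L} (hyx : y < x) (h : rk x = rk y + 1) : y ⋖ x := by
  refine ⟨hyx, fun z hyz hzx => ?_⟩
  have h₁ := hrk.strictMono hyz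
  have h₂ := hrk.strictMono hzx
  omega

section GradedPieces

variable {R : Type*} [Ring R] {L : Type*} [Lattice L] [BoundedOrder L] [Finite L]
  {rk : L → ℕ} {V : ℕ → Type*} [∀ i, AddCommGroup (V i)] [∀ i, Module R (V i)]
  {Vx : L → ∀ i, Submodule R (V i)}

/-- The subcomplex `V_{≤x}` vanishes in degrees above `rk x`. -/
theorem Vle_eq_bot_of_rk_lt (hrk : IsRankFunction rk)
    (hoff : ∀ (x : L) (i : ℕ), i ≠ rk x → Vx x i = ⊥) {x : L} {i : ℕ} (h : rk x < i) :
    Vle Vx x i = ⊥ := by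
  refine le_bot_iff.1 (iSup₂_le fun y hy => ?_)
  exact (hoff y i ((hrk.strictMono.monotone hy).trans_lt h).ne').le

/-- In the top degree `rk x`, the subcomplex `V_{≤x}` is the piece `V_x`. -/
theorem Vle_rk_eq (hrk : IsRankFunction rk)
    (hoff : ∀ (x : L) (i : ℕ), i ≠ rk x → Vx x i = ⊥) {x : L} {i : ℕ} (h : rk x = i) :
    Vle Vx x i = Vx x i := by
  refine le_antisymm (iSup₂_le fun y hy => ?_)
    (le_iSup₂_of_le x (show x ≤ x from le_rfl) le_rfl)
  rcases eq_or_lt_of_le (show y ≤ x from hy) with rfl | hlt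
  · exact le_rfl
  · rw [hoff y i (by have := hrk.strictMono hlt; omega)]
    exact bot_le

/-- In degree `rk x - 1`, the subcomplex `V_{≤x}` is `V_{≺x}`. -/
theorem Vle_eq_iSup_covBy (hrk : IsRankFunction rk)
    (hoff : ∀ (x : L) (i : ℕ), i ≠ rk x → Vx x i = ⊥) {x : L} {i : ℕ} (h : rk x = i + 1) :
    Vle Vx x i = ⨆ y ∈ {y : L | y ⋖ x}, Vx y i := by
  refine le_antisymm (iSup₂_le fun y hy => ?_)
    (biSup_mono fun y (hy : y ⋖ x) => hy.le)
  by_cases hi : i = rk y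
  · have hyx : y < x := lt_of_le_of_ne hy (by rintro rfl; omega)
    exact le_iSup₂_of_le y (hrk.covBy_of_lt hyx (by omega)) le_rfl
  · rw [hoff y i hi]
    exact bot_le

end GradedPieces

/-- A compatibly `L`-graded complex with injective atom differentials whose subcomplexes
`V_{≤x}` are all acyclic is the minimal complex of its atomic datum: for every `x` of rank
`≥ 2` the differential is injective on `V_x` and its image is the kernel of `∂` on `V_{≺x}`. -/
theorem stmt6 {L : Type*} [Lattice L] [Fintype L] [DecidableEq L] [BoundedOrder L]
    (hatom : Atomistic L) (hsemi : Semimodular L)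
    (rk : L → ℕ) (hrk : IsRankFunction rk)
    {R : Type*} [Ring R] (V : ℕ → Type*) [∀ i, AddCommGroup (V i)] [∀ i, Module R (V i)]
    (d : ∀ i, V (i + 1) →ₗ[R] V i) (Vx : L → ∀ i, Submodule R (V i))
    (hgr : IsCompatGrading rk V d Vx)
    (hbot : Vx ⊥ 0 = ⊤)
    (hinj : ∀ a : L, IsAtom a → ∀ v ∈ Vx a 1, d 0 v = 0 → v = 0)
    (hacy : ∀ x : L, AcyclicOn d Vx x) :
    ∀ (i : ℕ) (x : L), rk x = i + 2 →
      (∀ v ∈ Vx x (i + 2), d (i + 1) v = 0 → v = 0) ∧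
      Submodule.map (d (i + 1)) (Vx x (i + 2)) =
        (⨆ y ∈ {y : L | y ⋖ x}, Vx y (i + 1)) ⊓ LinearMap.ker (d i) := by
  intro i x hx
  obtain ⟨-, hoff, -, -⟩ := hgr
  have htop := hacy x (i + 1)
  have hnext := hacy x i
  rw [Vle_rk_eq hrk hoff hx, Vle_eq_bot_of_rk_lt hrk hoff (by omega), Submodule.map_bot] at htop
  rw [Vle_rk_eq hrk hoff hx, Vle_eq_iSup_covBy hrk hoff hx] at hnext
  refine ⟨fun v hv hdv => ?_, hnext.symm⟩
  rw [← Submodule.mem_bot R, ← htop]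
  exact ⟨hv, hdv⟩
end

section
/- Let L be a finite geometric lattice, R a ring with 1, D = (U_0, (U_a)) a non-degenerate atomic datum over R (U_a ≠ 0 for every atom a), and d_0 a compatible section for D with Coxeter numbers h^x (x ∈ L indecomposable). Then for all indecomposable x, z ∈ L with x ≤ z and every u ∈ U^x one has ((h^z − h^x) − Σ_{y indecomposable, x ⋖ y ≤ z} (h^y − h^x)) · u = 0; equivalently, h^z − h^x ≡ Σ_{y ∈ L indecomposable : x ⋖ y ≤ z} (h^y − h^x) modulo n_x, where n_x is the minimal positive integer with n_x U^x = 0 if such exists and n_x = 0 otherwise. -/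
/-- If every atom below `w` lies below `p` or `q`, then `w` is the join of its meets with `p`
and `q`. -/
theorem inf_sup_inf_eq_of_atoms_le {L : Type*} [Lattice L] [OrderBot L] (hatom : Atomistic L)
    {w p q : L} (h : ∀ a : L, IsAtom a → a ≤ w → a ≤ p ∨ a ≤ q) :
    (w ⊓ p) ⊔ (w ⊓ q) = w := by
  refine le_antisymm (sup_le inf_le_left inf_le_left) ?_
  obtain ⟨s, hs, hsw⟩ := hatom w
  conv_lhs => rw [← hsw]
  refine Finset.sup_le fun a ha => ?_
  have haw : a ≤ w := hsw ▸ Finset.le_sup (f := id) ha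
  rcases h a (hs a ha) haw with hp | hq
  · exact le_sup_of_le_left (le_inf haw hp)
  · exact le_sup_of_le_right (le_inf haw hq)

/-- In an atomistic lattice an element `≠ ⊥` has an atom below it. -/
theorem Atomistic.exists_isAtom_le {L : Type*} [Lattice L] [OrderBot L] (hatom : Atomistic L)
    {w : L} (hw : w ≠ ⊥) : ∃ a : L, IsAtom a ∧ a ≤ w := by
  obtain ⟨s, hs, rfl⟩ := hatom w
  obtain ⟨a, ha⟩ : s.Nonempty := by
    rw [Finset.nonempty_iff_ne_empty]
    rintro rfl
    exact hw Finset.sup_empty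
  exact ⟨a, hs a ha, Finset.le_sup (f := id) ha⟩

/-- If atoms below `w` are separated by `p` and `q`, and `w` meets both nontrivially, then `w` is
decomposable. -/
theorem decomposable_of_xor {L : Type*} [Lattice L] [OrderBot L] (hatom : Atomistic L)
    {w p q : L} (hp : w ⊓ p ≠ ⊥) (hq : w ⊓ q ≠ ⊥)
    (h : ∀ a : L, IsAtom a → a ≤ w → Xor (a ≤ p) (a ≤ q)) : Decomposable w := by
  refine ⟨w ⊓ p, w ⊓ q, hp, hq, inf_sup_inf_eq_of_atoms_le hatom fun a ha haw =>
    Xor.or (h a ha haw), fun a ha haw => ?_⟩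
  change Xor _ _
  simpa [haw] using h a ha haw

/-- If an indecomposable `x` is covered by a decomposable `y`, then `a ⊔ b` is decomposable for
all atoms `b ≤ x` and `a ≤ y` with `a ≰ x`. -/
theorem decomposable_sup_of_covBy {L : Type*} [Lattice L] [OrderBot L] (hatom : Atomistic L)
    {x y : L} (hx : Indecomposable x) (hxy : x ⋖ y) (hy : Decomposable y)
    {a b : L} (ha : IsAtom a) (hay : a ≤ y) (hax : ¬ a ≤ x) (hb : IsAtom b) (hbx : b ≤ x) :
    Decomposable (b ⊔ a) := by
  obtain ⟨p, q, hp, hq, hpq, h⟩ := hy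
  wlog hxq : x ⊓ q = ⊥ generalizing p q with H
  · refine H q p hq hp (sup_comm p q ▸ hpq) (fun a ha hay => (xor_comm _ _).mp (h a ha hay)) ?_
    by_contra hxp
    exact hx.2 (decomposable_of_xor hatom hxp hxq fun a ha hax => h a ha (hax.trans hxy.le))
  have hsup := inf_sup_inf_eq_of_atoms_le hatom fun a ha (hax : a ≤ x) =>
    Xor.or (h a ha (hax.trans hxy.le))
  rw [hxq, sup_bot_eq, inf_eq_left] at hsup
  have hpy : p ≠ y := by
    rintro rfl
    obtain ⟨e, he, heq⟩ := hatom.exists_isAtom_le hq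
    have hep : e ≤ p := heq.trans (le_sup_right.trans hpq.le)
    rcases h e he hep with h' | h'
    · exact h'.2 heq
    · exact h'.2 hep
  have hxp : p = x := (hxy.eq_or_eq hsup (le_sup_left.trans hpq.le)).resolve_right hpy
  subst hxp
  have haq : a ≤ q := (Xor.or (h a ha hay)).resolve_left hax
  have hby : b ⊔ a ≤ y := sup_le (hbx.trans hxy.le) hay
  exact decomposable_of_xor hatom
    (fun h0 => hb.1 (le_bot_iff.mp (h0 ▸ le_inf le_sup_left hbx)))
    (fun h0 => ha.1 (le_bot_iff.mp (h0 ▸ le_inf le_sup_right haq)))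
    fun e he hew => h e he (hew.trans hby)

/-- A linear map on a submodule containing each `N i` vanishes on `⨆ i ∈ s, N i` if it vanishes on
each `N i` with `i ∈ s`. -/
theorem LinearMap.eq_zero_of_mem_biSup {R M P ι : Type*} [Ring R] [AddCommGroup M] [Module R M]
    [AddCommGroup P] [Module R P] {S : Submodule R M} (f : S →ₗ[R] P) {N : ι → Submodule R M}
    {s : Set ι} (hN : ∀ i ∈ s, N i ≤ S) (hf : ∀ i ∈ s, ∀ u : S, (u : M) ∈ N i → f u = 0)
    (u : S) (hu : (u : M) ∈ ⨆ i ∈ s, N i) : f u = 0 := by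
  have hle : ⨆ i ∈ s, N i ≤ (LinearMap.ker f).map S.subtype :=
    iSup₂_le fun i hi v hv => ⟨⟨v, hN i hi hv⟩, hf i hi _ hv, rfl⟩
  obtain ⟨w, hw, hwu⟩ := hle hu
  exact Subtype.ext hwu ▸ hw

/-- Combinatorial relations among the Coxeter numbers of a compatible section `d_0`
(with components `c a : U^⊤ → U_a`) of a non-degenerate atomic datum: for indecomposable
`x ≤ z`, `(h^z − h^x) − ∑_{y indecomposable, x ⋖ y ≤ z} (h^y − h^x)` annihilates `U^x`. -/
theorem stmt9 {L : Type*} [Lattice L] [Fintype L] [BoundedOrder L]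
    [DecidablePred (fun a : L => IsAtom a)]
    [DecidableRel ((· ≤ ·) : L → L → Prop)]
    [DecidableRel ((· ⋖ ·) : L → L → Prop)]
    [DecidablePred (fun x : L => Indecomposable x)]
    (hatom : Atomistic L) (hsemi : Semimodular L)
    {R : Type*} [Ring R] {U0 : Type*} [AddCommGroup U0] [Module R U0]
    (Ua : L → Submodule R U0)
    (hnd : ∀ a : L, IsAtom a → Ua a ≠ ⊥)
    (c : L → (↥(⨆ a ∈ {a : L | IsAtom a}, Ua a) →ₗ[R] U0))
    (hc_range : ∀ a : L, IsAtom a → ∀ u, c a u ∈ Ua a)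
    (hcox : L → ℤ)
    (hunit : ∀ x : L, Indecomposable x → IsUnit ((hcox x : ℤ) : R))
    (hsec1 : ∀ x : L, Indecomposable x →
      ∀ u : ↥(⨆ a ∈ {a : L | IsAtom a}, Ua a),
        (u : U0) ∈ (⨆ a ∈ {a : L | IsAtom a ∧ a ≤ x}, Ua a) →
        (∑ a ∈ Finset.univ.filter (fun a : L => IsAtom a ∧ a ≤ x), c a u)
          = hcox x • (u : U0))
    (hsec2 : ∀ a a' : L, IsAtom a → IsAtom a' → Decomposable (a ⊔ a') →
      ∀ u : ↥(⨆ b ∈ {b : L | IsAtom b}, Ua b), (u : U0) ∈ Ua a → c a' u = 0)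
    (x z : L) (hxz : x ≤ z) (hx : Indecomposable x) (hz : Indecomposable z) :
    ∀ u : U0, u ∈ (⨆ a ∈ {a : L | IsAtom a ∧ a ≤ x}, Ua a) →
      ((hcox z - hcox x) -
        ∑ y ∈ Finset.univ.filter (fun y : L => Indecomposable y ∧ x ⋖ y ∧ y ≤ z),
          (hcox y - hcox x)) • u = 0 := by
  classical
  intro u hu
  have hsub : ∀ w : L, (⨆ a ∈ {a : L | IsAtom a ∧ a ≤ w}, Ua a) ≤
      ⨆ a ∈ {a : L | IsAtom a}, Ua a :=
    fun w => biSup_mono fun a ha => ha.1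
  have hmono : ∀ w : L, x ≤ w → u ∈ ⨆ a ∈ {a : L | IsAtom a ∧ a ≤ w}, Ua a := fun w hw =>
    (biSup_mono (fun a (ha : IsAtom a ∧ a ≤ x) => ⟨ha.1, ha.2.trans hw⟩) :
      (⨆ a ∈ {a : L | IsAtom a ∧ a ≤ x}, Ua a) ≤ ⨆ a ∈ {a : L | IsAtom a ∧ a ≤ w}, Ua a) hu
  let v : ↥(⨆ a ∈ {a : L | IsAtom a}, Ua a) := ⟨u, hsub x hu⟩
  have hdiff : ∀ w : L, x ≤ w → Indecomposable w →
      ∑ a with (IsAtom a ∧ a ≤ w) ∧ ¬ a ≤ x, c a v = (hcox w - hcox x) • u := by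
    intro w hxw hw
    have hw' := hsec1 w hw v (hmono w hxw)
    have hx' := hsec1 x hx v hu
    rw [← Finset.sum_filter_add_sum_filter_not _ (fun a => a ≤ x), Finset.filter_filter,
      Finset.filter_filter] at hw'
    have hfilter : (Finset.univ.filter fun a : L => (IsAtom a ∧ a ≤ w) ∧ a ≤ x) =
        Finset.univ.filter fun a : L => IsAtom a ∧ a ≤ x :=
      Finset.filter_congr fun a _ => ⟨fun h => ⟨h.1.1, h.2⟩, fun h => ⟨⟨h.1, h.2.trans hxw⟩, h.2⟩⟩
    rw [hfilter, hx'] at hw'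
    rw [sub_smul, eq_sub_iff_add_eq']
    exact hw'
  have hdec : ∀ y : L, x ⋖ y → ¬ Indecomposable y →
      ∑ a with (IsAtom a ∧ a ≤ y) ∧ ¬ a ≤ x, c a v = 0 := by
    intro y hxy hy
    have hy' : Decomposable y := by
      by_contra h
      exact hy ⟨(bot_le.trans_lt hxy.lt).ne', h⟩
    refine Finset.sum_eq_zero fun a ha => ?_
    obtain ⟨⟨ha, hay⟩, hax⟩ := (Finset.mem_filter.mp ha).2
    refine (c a).eq_zero_of_mem_biSup (fun b hb => le_biSup Ua hb.1) (fun b hb => ?_) v hu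
    exact hsec2 b a hb.1 ha (decomposable_sup_of_covBy hatom hx hxy hy' ha hay hax hb.1 hb.2)
  have hcov : ∀ a : L, IsAtom a → ¬ a ≤ x → x ⋖ x ⊔ a := fun a ha hax => by
    have hbot : a ⊓ x = ⊥ :=
      (ha.le_iff.mp inf_le_left).resolve_right fun h => hax (inf_eq_left.mp h)
    rw [sup_comm]
    exact hsemi a x (hbot ▸ ha.bot_covBy)
  have hfiber : ∑ a with (IsAtom a ∧ a ≤ z) ∧ ¬ a ≤ x, c a v =
      ∑ y with x ⋖ y ∧ y ≤ z, ∑ a with (IsAtom a ∧ a ≤ y) ∧ ¬ a ≤ x, c a v := by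
    rw [← Finset.sum_fiberwise_of_maps_to (g := fun a => x ⊔ a)
      (t := Finset.univ.filter fun y => x ⋖ y ∧ y ≤ z)]
    · refine Finset.sum_congr rfl fun y hy => Finset.sum_congr ?_ fun _ _ => rfl
      obtain ⟨hxy, hyz⟩ := (Finset.mem_filter.mp hy).2
      rw [Finset.filter_filter]
      refine Finset.filter_congr fun a _ => ⟨?_, ?_⟩
      · rintro ⟨⟨⟨ha, -⟩, hax⟩, rfl⟩
        exact ⟨⟨ha, le_sup_right⟩, hax⟩
      · rintro ⟨⟨ha, hay⟩, hax⟩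
        exact ⟨⟨⟨ha, hay.trans hyz⟩, hax⟩,
          (hxy.eq_or_eq le_sup_left (sup_le hxy.le hay)).resolve_left
            fun h => hax (h ▸ le_sup_right)⟩
    · intro a ha
      obtain ⟨⟨ha, haz⟩, hax⟩ := (Finset.mem_filter.mp ha).2
      exact Finset.mem_filter.mpr ⟨Finset.mem_univ _, hcov a ha hax, sup_le hxz haz⟩
  have hindec : ∑ y with x ⋖ y ∧ y ≤ z, ∑ a with (IsAtom a ∧ a ≤ y) ∧ ¬ a ≤ x, c a v =
      ∑ y with Indecomposable y ∧ x ⋖ y ∧ y ≤ z, (hcox y - hcox x) • u := by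
    rw [← Finset.sum_filter_of_ne (p := fun y => Indecomposable y), Finset.filter_filter]
    · refine Finset.sum_congr (Finset.filter_congr fun y _ => and_comm) fun y hy => ?_
      obtain ⟨hy, hxy, -⟩ := (Finset.mem_filter.mp hy).2
      exact hdiff y hxy.le hy
    · intro y hy hne
      by_contra h
      exact hne (hdec y (Finset.mem_filter.mp hy).2.1 h)
  rw [sub_smul, Finset.sum_smul, ← hindec, ← hfiber, hdiff z hxz hz, sub_self]
end
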